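/- arXiv:2002.05009 — 3 statements merged into one kernel-verified Lean document; each statement's English description precedes it below -/
import Mathlib

section
/- Assume W = V, V reflexive, j : V → H injective with dense range, a₁ a bounded sesquilinear form on V × V with inf-sup constant c > 0 and nondegenerate in the second component, T : V → V* its Lax–Milgram isomorphism, d a bounded sesquilinear form on H × V with C^V = C̃∘j, and j* : H* → V*, ψ ↦ ψ∘j. Then: (i) the closure in V × V* of the set {(u, j*φ) : u ∈ V, φ ∈ H*, a₁(u,v) = φ(jv) for all v ∈ V} equals the graph of T. (ii) If moreover the problem is strongly well-posed (for every ψ ∈ V* there is exactly one u ∈ V with a₁(u,v) + d(ju,v) = ψ(v) for all v ∈ V), then the closure in V × V* of {(u, j*φ) : u ∈ V, φ ∈ H*, a₁(u,v) + d(ju,v) = φ(jv) for all v ∈ V} equals the graph of T∘(I_V + C^V). -/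
open scoped ComplexConjugate

/-- A dense submodule is detected by continuous functionals: if every continuous functional
vanishing on `M` is zero, then `M` is dense. -/
theorem Submodule.dense_of_forall_dual_eq_zero {𝕂 E : Type*} [RCLike 𝕂]
    [NormedAddCommGroup E] [NormedSpace 𝕂 E] (M : Submodule 𝕂 E)
    (h : ∀ f : StrongDual 𝕂 E, (∀ x ∈ M, f x = 0) → f = 0) : Dense (M : Set E) := by
  intro x
  by_contra hx
  let N := M.topologicalClosure
  have : IsClosed (N : Set E) := M.isClosed_topologicalClosure
  have hne : N.mkQ x ≠ 0 := by
    rw [Submodule.mkQ_apply, Ne, Submodule.Quotient.mk_eq_zero]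
    exact hx
  obtain ⟨g, hg⟩ := SeparatingDual.exists_ne_zero (R := 𝕂) hne
  refine hg ?_
  have hf := h (g.comp N.mkQL) fun y hy ↦ by
    have hy0 : N.mkQ y = 0 := by
      rw [Submodule.mkQ_apply, Submodule.Quotient.mk_eq_zero]
      exact M.le_topologicalClosure hy
    change g (N.mkQ y) = 0
    rw [hy0, map_zero]
  exact DFunLike.congr_fun hf x

/-- On a reflexive space, continuous functionals on the antidual are point evaluations. -/
theorem exists_eval_eq_of_reflexive {𝕂 V : Type*} [RCLike 𝕂]
    [NormedAddCommGroup V] [NormedSpace 𝕂 V]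
    (hrefl : Function.Surjective ⇑(NormedSpace.inclusionInDoubleDual 𝕂 V))
    (f : StrongDual 𝕂 (V →SL[starRingEnd 𝕂] 𝕂)) : ∃ v : V, ∀ ψ, f ψ = ψ v := by
  let s : 𝕂 →SL[starRingEnd 𝕂] 𝕂 := (starL 𝕂 : 𝕂 ≃L⋆[𝕂] 𝕂)
  have hs (z : 𝕂) : s z = conj z := rfl
  let F : StrongDual 𝕂 (StrongDual 𝕂 V) := s.comp
    (f.comp (ContinuousLinearMap.compSL V 𝕂 𝕂 (RingHom.id 𝕂) (starRingEnd 𝕂) s))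
  obtain ⟨v, hv⟩ := hrefl F
  refine ⟨v, fun ψ ↦ ?_⟩
  have key := DFunLike.congr_fun hv (s.comp ψ)
  have hψ : s.comp (s.comp ψ) = ψ := by
    ext x
    simp [hs]
  have hF : F (s.comp ψ) = conj (f ψ) := by
    change s (f (s.comp (s.comp ψ))) = _
    rw [hψ, hs]
  rw [hF, NormedSpace.dual_def, ContinuousLinearMap.comp_apply, hs] at key
  exact ((starRingEnd 𝕂).injective key).symm

/-- The adjoint between antiduals of an injective operator on a reflexive space has dense range. -/
theorem denseRange_antidual_comp {𝕂 V H : Type*} [RCLike 𝕂]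
    [NormedAddCommGroup V] [NormedSpace 𝕂 V] [NormedAddCommGroup H] [NormedSpace 𝕂 H]
    (hrefl : Function.Surjective ⇑(NormedSpace.inclusionInDoubleDual 𝕂 V))
    (j : V →L[𝕂] H) (hj : Function.Injective ⇑j) :
    DenseRange fun φ : H →SL[starRingEnd 𝕂] 𝕂 ↦ φ.comp j := by
  let L : (H →SL[starRingEnd 𝕂] 𝕂) →ₗ[𝕂] (V →SL[starRingEnd 𝕂] 𝕂) :=
    { toFun := fun φ ↦ φ.comp j
      map_add' := fun _ _ ↦ rfl
      map_smul' := fun _ _ ↦ rfl }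
  have hL : Dense (LinearMap.range L : Set (V →SL[starRingEnd 𝕂] 𝕂)) := by
    refine Submodule.dense_of_forall_dual_eq_zero _ fun f hf ↦ ?_
    obtain ⟨v, hv⟩ := exists_eval_eq_of_reflexive hrefl f
    have hjv : j v = 0 := by
      refine SeparatingDual.eq_zero_of_forall_dual_eq_zero (R := 𝕂) fun g ↦ ?_
      let s : 𝕂 →SL[starRingEnd 𝕂] 𝕂 := (starL 𝕂 : 𝕂 ≃L⋆[𝕂] 𝕂)
      have h0 : conj (g (j v)) = 0 := by
        have := hf _ ⟨s.comp g, rfl⟩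
        rwa [hv] at this
      simpa using h0
    have hv0 : v = 0 := hj (by rw [hjv, map_zero])
    ext ψ
    rw [hv, hv0, map_zero, zero_apply]
  exact hL

/-- Restricting the graph of an isomorphism to a dense set of values does not change its
closure. -/
theorem ContinuousLinearEquiv.closure_graph_restrict {𝕂 V E ι : Type*} [RCLike 𝕂]
    [NormedAddCommGroup V] [NormedSpace 𝕂 V] [NormedAddCommGroup E] [NormedSpace 𝕂 E]
    (B : V ≃L[𝕂] E) {g : ι → E} (hg : DenseRange g) :
    closure {p : V × E | ∃ i, B p.1 = g i ∧ p.2 = g i} = {p : V × E | p.2 = B p.1} := by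
  apply Set.Subset.antisymm
  · refine closure_minimal ?_ (isClosed_eq continuous_snd (B.continuous.comp continuous_fst))
    rintro p ⟨i, h₁, h₂⟩
    exact h₂.trans h₁.symm
  · rintro ⟨u, ψ⟩ (rfl : ψ = B u)
    have hcont : Continuous fun ψ : E ↦ (B.symm ψ, ψ) := B.symm.continuous.prodMk continuous_id
    have := map_mem_closure (t := {p : V × E | ∃ i, B p.1 = g i ∧ p.2 = g i}) hcont (hg (B u)) (by
      rintro _ ⟨i, rfl⟩
      exact ⟨i, B.apply_symm_apply _, rfl⟩)
    simpa using this


/-- Theorem 3.8 h): with `W = V` reflexive and `j : V → H` injective with dense range,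
`j*∘A₁` is closable as an operator from `V` to `V*` with closure `T`, and if the
problem is strongly well-posed then `j*∘A` is closable with closure `T∘(I_V + C^V)`. -/
theorem closure_of_jstar_A
    {𝕂 V H : Type*} [RCLike 𝕂]
    [NormedAddCommGroup V] [NormedSpace 𝕂 V] [CompleteSpace V] [Nontrivial V]
    [NormedAddCommGroup H] [NormedSpace 𝕂 H] [CompleteSpace H]
    (hrefl : Function.Surjective ⇑(NormedSpace.inclusionInDoubleDual 𝕂 V))
    (j : V →L[𝕂] H) (hj : Function.Injective ⇑j) (hjdense : DenseRange ⇑j)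
    (a₁ : V →L[𝕂] (V →SL[starRingEnd 𝕂] 𝕂))
    (c : ℝ) (hc : 0 < c)
    (hinfsup : ∀ v : V, c * ‖v‖ ≤ ‖a₁ v‖)
    (hnondeg : ∀ w : V, (∀ v : V, a₁ v w = 0) → w = 0)
    (T : V ≃L[𝕂] (V →SL[starRingEnd 𝕂] 𝕂))
    (hT : ∀ v w : V, a₁ v w = T v w)
    (d : H →L[𝕂] (V →SL[starRingEnd 𝕂] 𝕂))
    (Ct : H →L[𝕂] V)
    (hCt : ∀ (x : H) (w : V), a₁ (Ct x) w = d x w) :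
    (closure {p : V × (V →SL[starRingEnd 𝕂] 𝕂) |
        ∃ φ : H →SL[starRingEnd 𝕂] 𝕂,
          (∀ v : V, a₁ p.1 v = φ (j v)) ∧ p.2 = φ.comp j}
      = {p : V × (V →SL[starRingEnd 𝕂] 𝕂) | p.2 = T p.1}) ∧
    ((∀ ψ : V →SL[starRingEnd 𝕂] 𝕂,
        ∃! u : V, ∀ v : V, a₁ u v + d (j u) v = ψ v) →
      closure {p : V × (V →SL[starRingEnd 𝕂] 𝕂) |
          ∃ φ : H →SL[starRingEnd 𝕂] 𝕂,
            (∀ v : V, a₁ p.1 v + d (j p.1) v = φ (j v)) ∧ p.2 = φ.comp j}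
        = {p : V × (V →SL[starRingEnd 𝕂] 𝕂) | p.2 = T (p.1 + Ct (j p.1))}) := by
  have hd := denseRange_antidual_comp hrefl j hj
  refine ⟨?_, fun hwp ↦ ?_⟩
  · rw [← T.closure_graph_restrict hd]
    simp only [ContinuousLinearMap.ext_iff (f := T _), ← hT, ContinuousLinearMap.comp_apply]
  · let B₀ : V →L[𝕂] (V →SL[starRingEnd 𝕂] 𝕂) :=
      (T : V →L[𝕂] _).comp (ContinuousLinearMap.id 𝕂 V + Ct.comp j)
    have hB₀ (u : V) : B₀ u = T (u + Ct (j u)) := rfl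
    have hB₀_apply (u v : V) : B₀ u v = a₁ u v + d (j u) v := by
      rw [hB₀, ← hT, map_add, add_apply, hCt]
    have hbij : Function.Bijective B₀ := by
      rw [Function.bijective_iff_existsUnique]
      intro ψ
      simpa only [ContinuousLinearMap.ext_iff, hB₀_apply] using hwp ψ
    let B := ContinuousLinearEquiv.ofBijective B₀ (LinearMap.ker_eq_bot.mpr hbij.1)
      (LinearMap.range_eq_top.mpr hbij.2)
    have hB (u : V) : B u = B₀ u := rfl
    have key := B.closure_graph_restrict hd
    simp only [hB, ContinuousLinearMap.ext_iff (f := B₀ _), hB₀_apply,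
      ContinuousLinearMap.comp_apply] at key
    exact key
end

section
/- Assume W = V, V reflexive, and that j : V → H is injective with dense range and is a compact operator. Let a₁ be a bounded sesquilinear form on V × V with inf-sup constant c > 0, nondegenerate in the second component, and let d be a bounded sesquilinear form on H × V. Then the following are equivalent: (i) for every ψ ∈ V* there exists exactly one u ∈ V with a₁(u,v) + d(ju,v) = ψ(v) for all v ∈ V (strong well-posedness); (ii) for every φ ∈ H* there exists exactly one u ∈ V with a₁(u,v) + d(ju,v) = φ(jv) for all v ∈ V (H-well-posedness). -/
/-- A closed proper subspace of a normed space is annihilated by a nonzero continuous functional. -/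
theorem Submodule.exists_dual_ne_zero_of_isClosed {𝕂 E : Type*} [RCLike 𝕂]
    [NormedAddCommGroup E] [NormedSpace 𝕂 E] (p : Submodule 𝕂 E)
    (hp : IsClosed (p : Set E)) (hne : p ≠ ⊤) :
    ∃ F : StrongDual 𝕂 E, F ≠ 0 ∧ ∀ x ∈ p, F x = 0 := by
  obtain ⟨x, -, hx⟩ := SetLike.exists_of_lt (lt_top_iff_ne_top.mpr hne)
  have hx' : p.mkQL x ≠ 0 := by simpa using hx
  obtain ⟨f, hf⟩ := SeparatingDual.exists_ne_zero (R := 𝕂) hx'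
  refine ⟨f.comp p.mkQL, fun h ↦ hf (by simpa using DFunLike.congr_fun h x), fun y hy ↦ ?_⟩
  have : p.mkQL y = 0 := by simpa using hy
  simp [this]

/-- On a reflexive space, every continuous functional on the antidual is an evaluation. -/
theorem NormedSpace.exists_eq_eval_antidual {𝕂 V : Type*} [RCLike 𝕂]
    [NormedAddCommGroup V] [NormedSpace 𝕂 V]
    (hrefl : Function.Surjective ⇑(NormedSpace.inclusionInDoubleDual 𝕂 V))
    (F : StrongDual 𝕂 (V →SL[starRingEnd 𝕂] 𝕂)) :
    ∃ w : V, ∀ ψ : V →SL[starRingEnd 𝕂] 𝕂, F ψ = ψ w := by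
  let σ : 𝕂 →SL[starRingEnd 𝕂] 𝕂 := (starL 𝕂 : 𝕂 ≃L⋆[𝕂] 𝕂)
  have hσ (z : 𝕂) : σ z = star z := rfl
  obtain ⟨w, hw⟩ := hrefl (σ.comp (F.comp
    (ContinuousLinearMap.compSL V 𝕂 𝕂 (RingHom.id 𝕂) (starRingEnd 𝕂) σ)))
  refine ⟨w, fun ψ ↦ ?_⟩
  have hψ : σ.comp (σ.comp ψ : V →L[𝕂] 𝕂) = ψ := by
    ext v
    simp [hσ]
  have h : (σ.comp ψ : V →L[𝕂] 𝕂) w = σ (F (σ.comp (σ.comp ψ : V →L[𝕂] 𝕂))) :=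
    DFunLike.congr_fun hw (σ.comp ψ)
  rw [hψ] at h
  exact (star_injective h).symm

/-- The **Banach–Nečas–Babuška theorem** on a reflexive space: an operator into the antidual that
is bounded below and nondegenerate in the second component is bijective. -/
theorem ContinuousLinearMap.bijective_of_bounded_below_of_nondegenerate {𝕂 V : Type*} [RCLike 𝕂]
    [NormedAddCommGroup V] [NormedSpace 𝕂 V] [CompleteSpace V]
    (hrefl : Function.Surjective ⇑(NormedSpace.inclusionInDoubleDual 𝕂 V))
    (a : V →L[𝕂] (V →SL[starRingEnd 𝕂] 𝕂)) {c : ℝ} (hc : 0 < c)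
    (hinfsup : ∀ v : V, c * ‖v‖ ≤ ‖a v‖)
    (hnondeg : ∀ w : V, (∀ v : V, a v w = 0) → w = 0) :
    Function.Bijective a := by
  obtain ⟨K, hK⟩ : ∃ K, AntilipschitzWith K a :=
    antilipschitzWith_iff_exists_mul_le_norm.mpr ⟨c, hc, hinfsup⟩
  refine ⟨hK.injective, ?_⟩
  have hclosed : IsClosed (a.range : Set (V →SL[starRingEnd 𝕂] 𝕂)) := by
    rw [LinearMap.coe_range]
    exact hK.isClosed_range a.uniformContinuous
  rw [← ContinuousLinearMap.coe_coe, ← LinearMap.range_eq_top]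
  by_contra hne
  obtain ⟨F, hF, hFa⟩ := Submodule.exists_dual_ne_zero_of_isClosed _ hclosed hne
  obtain ⟨w, hw⟩ := NormedSpace.exists_eq_eval_antidual hrefl F
  have hw0 : w = 0 := hnondeg w fun v ↦ by rw [← hw]; exact hFa _ ⟨v, rfl⟩
  exact hF (by ext ψ; simp [hw, hw0])

/-- An injective compact perturbation of a bijective operator between Banach spaces is
surjective. -/
theorem IsCompactOperator.surjective_add_of_injective {𝕂 E F : Type*}
    [NontriviallyNormedField 𝕂]
    [NormedAddCommGroup E] [NormedSpace 𝕂 E] [CompleteSpace E]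
    [NormedAddCommGroup F] [NormedSpace 𝕂 F] [CompleteSpace F]
    {A D : E →L[𝕂] F} (hD : IsCompactOperator D) (hA : Function.Bijective A)
    (hinj : Function.Injective (A + D)) : Function.Surjective (A + D) := by
  let e := ContinuousLinearEquiv.ofBijective A (LinearMap.ker_eq_bot.mpr hA.1)
    (LinearMap.range_eq_top.mpr hA.2)
  have he (v : E) : e v = A v := rfl
  let T : E →L[𝕂] E := -((e.symm : F →L[𝕂] E).comp D)
  have hT : IsCompactOperator T := (hD.clm_comp (e.symm : F →L[𝕂] E)).neg
  have heT (v : E) : e (v - T v) = (A + D) v := by simp [T, he v]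
  rcases hT.hasEigenvalue_or_mem_resolventSet one_ne_zero with h | h
  · obtain ⟨v, hv⟩ := h.exists_hasEigenvector
    have hTv : T v = v := by simpa using hv.apply_eq_smul
    exact absurd (hinj (by rw [← heT v, hTv, sub_self, map_zero, map_zero])) hv.2
  · rw [spectrum.mem_resolventSet_iff, ContinuousLinearMap.isUnit_iff_bijective] at h
    intro y
    obtain ⟨v, hv⟩ := h.2 (e.symm y)
    have hv' : v - T v = e.symm y := by simpa using hv
    exact ⟨v, by rw [← heT, hv', e.apply_symm_apply]⟩

/-- Corollary 3.9: with `W = V` reflexive and `j : V → H` injective, with dense range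
and compact, the variational problem is strongly well-posed if and only if it is
H-well-posed. -/
theorem strongly_well_posed_iff_H_well_posed
    {𝕂 V H : Type*} [RCLike 𝕂]
    [NormedAddCommGroup V] [NormedSpace 𝕂 V] [CompleteSpace V] [Nontrivial V]
    [NormedAddCommGroup H] [NormedSpace 𝕂 H] [CompleteSpace H]
    (hrefl : Function.Surjective ⇑(NormedSpace.inclusionInDoubleDual 𝕂 V))
    (j : V →L[𝕂] H) (hj : Function.Injective ⇑j) (hjdense : DenseRange ⇑j)
    (hjcompact : IsCompactOperator ⇑j)
    (a₁ : V →L[𝕂] (V →SL[starRingEnd 𝕂] 𝕂))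
    (c : ℝ) (hc : 0 < c)
    (hinfsup : ∀ v : V, c * ‖v‖ ≤ ‖a₁ v‖)
    (hnondeg : ∀ w : V, (∀ v : V, a₁ v w = 0) → w = 0)
    (d : H →L[𝕂] (V →SL[starRingEnd 𝕂] 𝕂)) :
    (∀ ψ : V →SL[starRingEnd 𝕂] 𝕂, ∃! u : V, ∀ v : V, a₁ u v + d (j u) v = ψ v) ↔
    (∀ φ : H →SL[starRingEnd 𝕂] 𝕂, ∃! u : V, ∀ v : V, a₁ u v + d (j u) v = φ (j v)) := by
  refine ⟨fun h φ ↦ h (φ.comp j), fun h ψ ↦ ?_⟩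
  have hA := a₁.bijective_of_bounded_below_of_nondegenerate hrefl hc hinfsup hnondeg
  have hD : IsCompactOperator (d.comp j) := hjcompact.clm_comp d
  have hinj : Function.Injective (a₁ + d.comp j) := by
    rw [injective_iff_map_eq_zero]
    intro u hu
    exact (h 0).unique (fun v ↦ by simpa using DFunLike.congr_fun hu v) (fun v ↦ by simp)
  obtain ⟨u, hu⟩ := hD.surjective_add_of_injective hA hinj ψ
  refine ⟨u, fun v ↦ by simp [← hu], fun u' hu' ↦ hinj ?_⟩
  rw [hu]
  ext v
  simpa using hu' v
end

section
/- Let E be a topological space, X a Banach space over 𝕂, U ⊆ X nonempty and open, 𝔞₁ : E → S(V × W, 𝕂) and 𝔠 : E × U → S(H × W, 𝕂) continuous, each 𝔞₁(t) satisfying the inf-sup condition with constant c(t) > 0 and nondegenerate in the second component. Assume there exists a directed set 𝔸 and a net (t_α)_{α ∈ 𝔸} in E such that ‖𝔠(t_α, m)‖_{S(H×W,𝕂)}/c(t_α) → 0 for every m ∈ U. Then there exists a nonempty set 𝒪 ⊆ E × U, open in E × X, such that: (a) for every m ∈ U there is a nonempty open set 𝒪_m ⊆ E with 𝒪_m ×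 {m} ⊆ 𝒪; (b) I_H + C_{t,m} is invertible in L(H) for all (t,m) ∈ 𝒪; (c) I_V + C^V_{t,m} is invertible in L(V) for all (t,m) ∈ 𝒪, and both the operator and its inverse depend continuously on (t,m) ∈ 𝒪; (d) for every (t,m) ∈ 𝒪 and φ ∈ W* there is exactly one u ∈ V with 𝔞₁(t)(u,w) + 𝔠(t,m)(ju,w) = φ(w) for all w ∈ W, u depends continuously on (t,m,φ), and ‖u‖_V ≤ (1/c(t))·‖(I_V + C^V_{t,m})⁻¹‖_{L(V)}·‖φ‖_{W*}. -/
/-- A continuous linear functional vanishing on a proper closed subspace but not identically. -/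
theorem Submodule.exists_strongDual_eq_zero_of_notMem {𝕂 F : Type*} [RCLike 𝕂]
    [NormedAddCommGroup F] [NormedSpace 𝕂 F] (S : Submodule 𝕂 F) (hS : IsClosed (S : Set F))
    {x : F} (hx : x ∉ S) : ∃ f : StrongDual 𝕂 F, (∀ y ∈ S, f y = 0) ∧ f x ≠ 0 := by
  have hx' : S.mkQ x ≠ 0 := by simpa using hx
  obtain ⟨g, hg⟩ := SeparatingDual.exists_ne_zero (R := 𝕂) hx'
  refine ⟨g.comp S.mkQL, fun y hy => ?_, hg⟩
  have : S.mkQ y = 0 := by simpa using hy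
  simpa using! congrArg g this

/-- On a reflexive space, every functional on the antidual is evaluation at a point. -/
theorem exists_eval_eq_of_surjective_inclusionInDoubleDual {𝕂 W : Type*} [RCLike 𝕂]
    [NormedAddCommGroup W] [NormedSpace 𝕂 W]
    (hrefl : Function.Surjective ⇑(NormedSpace.inclusionInDoubleDual 𝕂 W))
    (f : StrongDual 𝕂 (W →SL[starRingEnd 𝕂] 𝕂)) : ∃ w : W, ∀ φ, f φ = φ w := by
  let s : 𝕂 →SL[starRingEnd 𝕂] 𝕂 := (starL 𝕂 : 𝕂 ≃L⋆[𝕂] 𝕂)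
  let g : StrongDual 𝕂 (StrongDual 𝕂 W) :=
    s.comp (f.comp (ContinuousLinearMap.compSL W 𝕂 𝕂 (RingHom.id 𝕂) (starRingEnd 𝕂) s))
  obtain ⟨w, hw⟩ := hrefl g
  refine ⟨w, fun φ => ?_⟩
  have h : (s.comp φ : StrongDual 𝕂 W) w = g (s.comp φ) := by
    rw [← hw, NormedSpace.dual_def]
  have hs : s.comp (s.comp φ : StrongDual 𝕂 W) = φ := by
    ext x
    exact star_star (φ x)
  have h' : star (φ w) = star (f (s.comp (s.comp φ : StrongDual 𝕂 W))) := h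
  rw [hs] at h'
  exact (star_injective h').symm

/-- The Banach–Nečas–Babuška theorem for a sesquilinear form on `V × W`, seen as an operator from
`V` to the antidual of the reflexive space `W`. -/
theorem ContinuousLinearMap.isInvertible_of_infSup {𝕂 V W : Type*} [RCLike 𝕂]
    [NormedAddCommGroup V] [NormedSpace 𝕂 V] [CompleteSpace V]
    [NormedAddCommGroup W] [NormedSpace 𝕂 W]
    (hrefl : Function.Surjective ⇑(NormedSpace.inclusionInDoubleDual 𝕂 W))
    (a : V →L[𝕂] (W →SL[starRingEnd 𝕂] 𝕂)) {c : ℝ} (hc : 0 < c)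
    (hinfsup : ∀ v : V, c * ‖v‖ ≤ ‖a v‖)
    (hnondeg : ∀ w : W, (∀ v : V, a v w = 0) → w = 0) : a.IsInvertible := by
  have hanti : AntilipschitzWith (⟨c, hc.le⟩⁻¹ : NNReal) a := by
    refine a.antilipschitz_of_bound fun v => ?_
    change ‖v‖ ≤ c⁻¹ * ‖a v‖
    rw [inv_mul_eq_div, le_div_iff₀' hc]
    exact hinfsup v
  have hclosed : IsClosed (a.range : Set (W →SL[starRingEnd 𝕂] 𝕂)) := by
    simpa using! hanti.isClosed_range a.uniformContinuous
  have hrange : a.range = ⊤ := by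
    by_contra hne
    obtain ⟨φ, hφ⟩ : ∃ φ, φ ∉ a.range := by
      simpa [Submodule.eq_top_iff'] using hne
    obtain ⟨f, hf, hfφ⟩ := a.range.exists_strongDual_eq_zero_of_notMem hclosed hφ
    obtain ⟨w, hw⟩ := exists_eval_eq_of_surjective_inclusionInDoubleDual hrefl f
    have hw0 : w = 0 := hnondeg w fun v => by
      rw [← hw]
      exact hf _ ⟨v, rfl⟩
    exact hfφ (by rw [hw, hw0, map_zero])
  have hker : a.ker = ⊥ := LinearMap.ker_eq_bot.2 hanti.injective
  exact ⟨ContinuousLinearEquiv.ofBijective a hker hrange, by ext; simp⟩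

/-- If `1 + S ∘ T` is invertible, then `1 + T ∘ S` is bijective. -/
theorem ContinuousLinearMap.bijective_add_comp_of_isUnit {𝕂 V H : Type*} [NontriviallyNormedField 𝕂]
    [NormedAddCommGroup V] [NormedSpace 𝕂 V] [NormedAddCommGroup H] [NormedSpace 𝕂 H]
    (S : H →L[𝕂] V) (T : V →L[𝕂] H) (h : IsUnit (1 + S.comp T)) :
    Function.Bijective fun x : H => x + T (S x) := by
  obtain ⟨u, hu⟩ := h
  have hl (v : V) : u⁻¹.val (v + S (T v)) = v := by
    have := congrArg (fun A : V →L[𝕂] V => A v) u.inv_mul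
    simpa [hu] using this
  have hr (v : V) : u⁻¹.val v + S (T (u⁻¹.val v)) = v := by
    have := congrArg (fun A : V →L[𝕂] V => A v) u.mul_inv
    simpa [hu] using this
  refine Function.bijective_iff_has_inverse.2 ⟨fun y => y - T (u⁻¹.val (S y)), fun x => ?_,
    fun y => ?_⟩
  · simp only [map_add S, hl]
    abel
  · have := congrArg T (hr (S y))
    simp only [map_add, map_sub] at this ⊢
    rw [← this]
    abel

/-- Theorem 4.3 (local version): if there is a net `(t_α)` in `E` along which
`‖𝔠(t_α,m)‖ / c(t_α) → 0` for every `m ∈ U`, then there is a nonempty set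
`𝒪 ⊆ E × U`, open in `E × X`, such that: for every `m ∈ U` some nonempty open
`𝒪_m ⊆ E` satisfies `𝒪_m × {m} ⊆ 𝒪`; `I_H + C_{t,m}` is invertible on `𝒪`;
`I_V + C^V_{t,m}` is invertible on `𝒪` with operator and inverse depending
continuously on `(t,m)`; and the variational problem is uniquely solvable on `𝒪`,
the solution depending continuously on `(t,m,φ)` and obeying the norm bound. -/
theorem local_well_posedness
    {𝕂 V W H X E 𝔸 : Type*} [RCLike 𝕂] [TopologicalSpace E]
    [Nonempty 𝔸] [Preorder 𝔸] [IsDirected 𝔸 (· ≤ ·)]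
    [NormedAddCommGroup V] [NormedSpace 𝕂 V] [CompleteSpace V]
    [NormedAddCommGroup W] [NormedSpace 𝕂 W] [CompleteSpace W] [Nontrivial W]
    [NormedAddCommGroup H] [NormedSpace 𝕂 H] [CompleteSpace H]
    [NormedAddCommGroup X] [NormedSpace 𝕂 X] [CompleteSpace X]
    (hrefl : Function.Surjective ⇑(NormedSpace.inclusionInDoubleDual 𝕂 W))
    (j : V →L[𝕂] H) (hj : Function.Injective ⇑j)
    (U : Set X) (hUopen : IsOpen U) (hUne : U.Nonempty)
    (𝔞₁ : E → (V →L[𝕂] (W →SL[starRingEnd 𝕂] 𝕂))) (h𝔞₁ : Continuous 𝔞₁)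
    (𝔠 : E × X → (H →L[𝕂] (W →SL[starRingEnd 𝕂] 𝕂)))
    (h𝔠 : ContinuousOn 𝔠 (Set.univ ×ˢ U))
    (c : E → ℝ) (hc : ∀ t, 0 < c t)
    (hinfsup : ∀ (t : E) (v : V), c t * ‖v‖ ≤ ‖𝔞₁ t v‖)
    (hnondeg : ∀ (t : E) (w : W), (∀ v : V, 𝔞₁ t v w = 0) → w = 0)
    (Ct : E → X → (H →L[𝕂] V))
    (hCt : ∀ (t : E), ∀ m ∈ U, ∀ (x : H) (w : W),
      𝔞₁ t ((Ct t m) x) w = 𝔠 (t, m) x w)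
    (tnet : 𝔸 → E)
    (hnet : ∀ m ∈ U, Filter.Tendsto (fun α : 𝔸 => ‖𝔠 (tnet α, m)‖ / c (tnet α))
      Filter.atTop (nhds 0)) :
    ∃ 𝒪 : Set (E × X), 𝒪.Nonempty ∧ IsOpen 𝒪 ∧ 𝒪 ⊆ Set.univ ×ˢ U ∧
      (∀ m ∈ U, ∃ 𝒪m : Set E, 𝒪m.Nonempty ∧ IsOpen 𝒪m ∧ 𝒪m ×ˢ ({m} : Set X) ⊆ 𝒪) ∧
      (∀ p ∈ 𝒪, Function.Bijective fun x : H => x + j (Ct p.1 p.2 x)) ∧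
      ContinuousOn (fun p : E × X => (Ct p.1 p.2).comp j) 𝒪 ∧
      ∃ Binv : E × X → (V →L[𝕂] V),
        ContinuousOn Binv 𝒪 ∧
        (∀ p ∈ 𝒪, (∀ v : V, Binv p (v + Ct p.1 p.2 (j v)) = v) ∧
                   (∀ v : V, Binv p v + Ct p.1 p.2 (j (Binv p v)) = v)) ∧
        ∃ sol : (E × X) × (W →SL[starRingEnd 𝕂] 𝕂) → V,
          ContinuousOn sol (𝒪 ×ˢ Set.univ) ∧
          ∀ p ∈ 𝒪, ∀ φ : W →SL[starRingEnd 𝕂] 𝕂,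
            (∀ w : W, 𝔞₁ p.1 (sol (p, φ)) w + 𝔠 p (j (sol (p, φ))) w = φ w) ∧
            (∀ u : V, (∀ w : W, 𝔞₁ p.1 u w + 𝔠 p (j u) w = φ w) → u = sol (p, φ)) ∧
            ‖sol (p, φ)‖ ≤ (1 / c p.1) * ‖Binv p‖ * ‖φ‖ := by
  have hinv (t : E) : (𝔞₁ t).IsInvertible :=
    (𝔞₁ t).isInvertible_of_infSup hrefl (hc t) (hinfsup t) (hnondeg t)
  have hbound (t : E) (φ : W →SL[starRingEnd 𝕂] 𝕂) : c t * ‖(𝔞₁ t).inverse φ‖ ≤ ‖φ‖ := by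
    simpa [(hinv t).self_apply_inverse] using hinfsup t ((𝔞₁ t).inverse φ)
  have hinv_cont : Continuous fun t => (𝔞₁ t).inverse :=
    continuous_iff_continuousAt.2 fun t =>
      ((hinv t).contDiffAt_map_inverse (n := 0)).continuousAt.comp h𝔞₁.continuousAt
  have hCt_apply {t : E} {m : X} (hm : m ∈ U) (x : H) : 𝔞₁ t (Ct t m x) = 𝔠 (t, m) x :=
    ContinuousLinearMap.ext (hCt t m hm x)
  have hCt_eq {p : E × X} (hp : p ∈ Set.univ ×ˢ U) :
      Ct p.1 p.2 = (𝔞₁ p.1).inverse.comp (𝔠 p) := by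
    ext x
    rw [ContinuousLinearMap.comp_apply, ← hCt_apply hp.2, (hinv p.1).inverse_apply_self]
  have hCV : ContinuousOn (fun p : E × X => (Ct p.1 p.2).comp j) (Set.univ ×ˢ U) := by
    refine ContinuousOn.clm_comp ?_ continuousOn_const
    exact ((hinv_cont.comp continuous_fst).continuousOn.clm_comp h𝔠).congr fun p hp => hCt_eq hp
  let F : E × X → (V →L[𝕂] V) := fun p => 1 + (Ct p.1 p.2).comp j
  have hF : ContinuousOn F (Set.univ ×ˢ U) := continuousOn_const.add hCV
  let 𝒪 : Set (E × X) := (Set.univ ×ˢ U) ∩ F ⁻¹' {A | IsUnit A}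
  have h𝒪 : IsOpen 𝒪 := hF.isOpen_inter_preimage (isOpen_univ.prod hUopen) Units.isOpen
  have hsub : 𝒪 ⊆ Set.univ ×ˢ U := Set.inter_subset_left
  have hexists (m : X) (hm : m ∈ U) : ∃ t, (t, m) ∈ 𝒪 := by
    have hlim : Filter.Tendsto (fun α : 𝔸 => ‖𝔠 (tnet α, m)‖ / c (tnet α) * ‖j‖)
        Filter.atTop (nhds 0) := by
      simpa using (hnet m hm).mul_const ‖j‖
    obtain ⟨α, hα⟩ := (hlim.eventually (gt_mem_nhds zero_lt_one)).exists
    refine ⟨tnet α, ⟨Set.mem_univ _, hm⟩, ?_⟩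
    have hnorm : ‖Ct (tnet α) m‖ ≤ ‖𝔠 (tnet α, m)‖ / c (tnet α) := by
      refine ContinuousLinearMap.opNorm_le_bound _
        (div_nonneg (ContinuousLinearMap.opNorm_nonneg _) (hc _).le) fun x => ?_
      rw [div_mul_eq_mul_div, le_div_iff₀' (hc _)]
      refine (hinfsup _ _).trans ?_
      rw [hCt_apply hm]
      exact ContinuousLinearMap.le_opNorm _ _
    have hlt : ‖-((Ct (tnet α) m).comp j)‖ < 1 := by
      rw [norm_neg]
      exact ((ContinuousLinearMap.opNorm_comp_le _ _).trans
        (mul_le_mul_of_nonneg_right hnorm (norm_nonneg _))).trans_lt hα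
    simpa [F] using isUnit_one_sub_of_norm_lt_one hlt
  have hBinv : ContinuousOn (fun p => Ring.inverse (F p)) 𝒪 := by
    rintro p ⟨hp, u, hu⟩
    have := NormedRing.inverse_continuousAt u
    rw [hu] at this
    exact this.comp_continuousWithinAt ((hF p hp).mono hsub)
  have hleft {p : E × X} (hp : p ∈ 𝒪) (v : V) :
      Ring.inverse (F p) (v + Ct p.1 p.2 (j v)) = v := by
    simpa [F] using congrArg (fun A : V →L[𝕂] V => A v) (Ring.inverse_mul_cancel _ hp.2)
  have hright {p : E × X} (hp : p ∈ 𝒪) (v : V) :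
      Ring.inverse (F p) v + Ct p.1 p.2 (j (Ring.inverse (F p) v)) = v := by
    simpa [F] using congrArg (fun A : V →L[𝕂] V => A v) (Ring.mul_inverse_cancel _ hp.2)
  have hform {p : E × X} (hp : p ∈ 𝒪) (u : V) :
      𝔞₁ p.1 u + 𝔠 p (j u) = 𝔞₁ p.1 (u + Ct p.1 p.2 (j u)) := by
    rw [map_add, hCt_apply hp.1.2]
  refine ⟨𝒪, ?_, h𝒪, hsub, fun m hm => ?_, fun p hp => ?_, hCV.mono hsub,
    fun p => Ring.inverse (F p), hBinv, fun p hp => ⟨hleft hp, hright hp⟩,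
    fun q => Ring.inverse (F q.1) ((𝔞₁ q.1.1).inverse q.2), ?_, fun p hp φ => ⟨?_, ?_, ?_⟩⟩
  · obtain ⟨m, hm⟩ := hUne
    obtain ⟨t, ht⟩ := hexists m hm
    exact ⟨_, ht⟩
  · refine ⟨(fun t => (t, m)) ⁻¹' 𝒪, hexists m hm, h𝒪.preimage (by fun_prop), ?_⟩
    rintro ⟨t, m'⟩ ⟨ht, rfl⟩
    exact ht
  · exact (Ct p.1 p.2).bijective_add_comp_of_isUnit j hp.2
  · refine (hBinv.comp continuousOn_fst fun q hq => hq.1).clm_apply (Continuous.continuousOn ?_)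
    exact (hinv_cont.comp (continuous_fst.comp continuous_fst)).clm_apply continuous_snd
  · intro w
    have := hform hp (Ring.inverse (F p) ((𝔞₁ p.1).inverse φ))
    rw [hright hp, (hinv p.1).self_apply_inverse] at this
    exact congrArg (fun ψ : W →SL[starRingEnd 𝕂] 𝕂 => ψ w) this
  · intro u hu
    have hu' : 𝔞₁ p.1 u + 𝔠 p (j u) = φ := ContinuousLinearMap.ext hu
    rw [hform hp] at hu'
    subst hu'
    dsimp only
    rw [(hinv p.1).inverse_apply_self, hleft hp]
  · calc ‖Ring.inverse (F p) ((𝔞₁ p.1).inverse φ)‖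
        ≤ ‖Ring.inverse (F p)‖ * ‖(𝔞₁ p.1).inverse φ‖ := ContinuousLinearMap.le_opNorm _ _
      _ ≤ ‖Ring.inverse (F p)‖ * (‖φ‖ / c p.1) := by
        gcongr
        rw [le_div_iff₀' (hc _)]
        exact hbound _ _
      _ = 1 / c p.1 * ‖Ring.inverse (F p)‖ * ‖φ‖ := by ring
end
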